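/- arXiv:2410.21544 — 2 statements merged into one kernel-verified Lean document; each statement's English description precedes it below -/
import Mathlib

section
/- Fix κ ≠ 0 and n ≥ 2. For each j define the null vector operator acting on four times continuously differentiable functions ψ on the chamber 𝔜^n = {θ ∈ ℝ^n : θ_1 < θ_2 < … < θ_n < θ_1 + 2π} by (𝓛_j ψ)(θ) = (κ/2)·∂^2ψ/∂θ_j^2 + Σ_{k≠j} [ cot((θ_k−θ_j)/2)·∂ψ/∂θ_k − ((6−κ)/(2κ))·ψ(θ)/(2 sin^2((θ_k−θ_j)/2)) ]. Then for all i ≠ j, every four times continuously differentiable ψ : 𝔜^n → ℝ and every θ ∈ 𝔜^n, the commutation relation holds: 𝓛_i(𝓛_j ψ)(θ) − 𝓛_j(𝓛_i ψ)(θ) = (1/sin^2((θ_i−θ_j)/2))·( (𝓛_j ψ)(θ) − (𝓛_i ψ)(θ) ). -/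
open Finset

/-- The angular chamber `𝔜^n = {θ : θ_1 < θ_2 < … < θ_n < θ_1 + 2π}`. -/
def chamber (n : ℕ) : Set (Fin n → ℝ) :=
  {θ | StrictMono θ ∧ ∀ i j : Fin n, θ i < θ j + 2 * Real.pi}

/-- Partial derivative in the `j`-th coordinate direction. -/
noncomputable def pd (n : ℕ) (j : Fin n) (ψ : (Fin n → ℝ) → ℝ) (θ : Fin n → ℝ) : ℝ :=
  fderiv ℝ ψ θ (Pi.single j 1 : Fin n → ℝ)

/-- The null vector operator `𝓛_j`. -/
noncomputable def Lop (n : ℕ) (κ : ℝ) (j : Fin n) (ψ : (Fin n → ℝ) → ℝ)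
    (θ : Fin n → ℝ) : ℝ :=
  κ / 2 * pd n j (pd n j ψ) θ
    + ∑ k ∈ univ.filter (fun k => k ≠ j),
        (Real.cos ((θ k - θ j) / 2) / Real.sin ((θ k - θ j) / 2) * pd n k ψ θ
          - (6 - κ) / (2 * κ) * ψ θ / (2 * Real.sin ((θ k - θ j) / 2) ^ 2))

section NullVectorCommutation

variable {n : ℕ} {θ : Fin n → ℝ}

lemma isOpen_chamber (n : ℕ) : IsOpen (chamber n) := by
  have h : chamber n = (⋂ i : Fin n, ⋂ j : Fin n, {θ : Fin n → ℝ | i < j → θ i < θ j}) ∩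
      ⋂ i : Fin n, ⋂ j : Fin n, {θ : Fin n → ℝ | θ i < θ j + 2 * Real.pi} := by
    ext θ
    simp [chamber, StrictMono]
  rw [h]
  refine IsOpen.inter (isOpen_iInter_of_finite fun i => isOpen_iInter_of_finite fun j => ?_)
    (isOpen_iInter_of_finite fun i => isOpen_iInter_of_finite fun j => ?_)
  · by_cases hij : i < j
    · simpa [hij] using isOpen_lt (continuous_apply i) (continuous_apply j)
    · simp [hij]
  · exact isOpen_lt (continuous_apply i) ((continuous_apply j).add continuous_const)

lemma sin_half_sub_ne_zero (hθ : θ ∈ chamber n) {k j : Fin n} (hkj : k ≠ j) :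
    Real.sin ((θ k - θ j) / 2) ≠ 0 := by
  have h1 := hθ.2 k j
  have h2 := hθ.2 j k
  have h3 : θ k ≠ θ j := hθ.1.injective.ne hkj
  rw [Ne, Real.sin_eq_zero_iff_of_lt_of_lt (by linarith) (by linarith)]
  intro h
  exact h3 (by linarith)

/-- `f` is differentiable at `θ`, with partial derivative `v` in the `m`-th direction. -/
def HasPD (m : Fin n) (f : (Fin n → ℝ) → ℝ) (v : ℝ) (θ : Fin n → ℝ) : Prop :=
  DifferentiableAt ℝ f θ ∧ pd n m f θ = v

namespace HasPD

variable {m : Fin n} {f g : (Fin n → ℝ) → ℝ} {a b : ℝ}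

lemma of_hasFDerivAt {f' : (Fin n → ℝ) →L[ℝ] ℝ} (h : HasFDerivAt f f' θ) :
    HasPD m f (f' (Pi.single m 1)) θ :=
  ⟨h.differentiableAt, by rw [pd, h.fderiv]⟩

lemma add (hf : HasPD m f a θ) (hg : HasPD m g b θ) :
    HasPD m (fun x => f x + g x) (a + b) θ := by
  obtain ⟨hf, rfl⟩ := hf
  obtain ⟨hg, rfl⟩ := hg
  exact of_hasFDerivAt (hf.hasFDerivAt.add hg.hasFDerivAt)

lemma sub (hf : HasPD m f a θ) (hg : HasPD m g b θ) :
    HasPD m (fun x => f x - g x) (a - b) θ := by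
  obtain ⟨hf, rfl⟩ := hf
  obtain ⟨hg, rfl⟩ := hg
  exact of_hasFDerivAt (hf.hasFDerivAt.sub hg.hasFDerivAt)

lemma mul (hf : HasPD m f a θ) (hg : HasPD m g b θ) :
    HasPD m (fun x => f x * g x) (f θ * b + g θ * a) θ := by
  obtain ⟨hf, rfl⟩ := hf
  obtain ⟨hg, rfl⟩ := hg
  exact of_hasFDerivAt (hf.hasFDerivAt.mul hg.hasFDerivAt)

lemma const_mul (c : ℝ) (hf : HasPD m f a θ) : HasPD m (fun x => c * f x) (c * a) θ := by
  obtain ⟨hf, rfl⟩ := hf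
  exact of_hasFDerivAt (hf.hasFDerivAt.const_mul c)

lemma sum {ι : Type*} (s : Finset ι) {F : ι → (Fin n → ℝ) → ℝ} {A : ι → ℝ}
    (h : ∀ k ∈ s, HasPD m (F k) (A k) θ) :
    HasPD m (fun x => ∑ k ∈ s, F k x) (∑ k ∈ s, A k) θ := by
  have key := of_hasFDerivAt (m := m)
    (HasFDerivAt.fun_sum fun k hk => (h k hk).1.hasFDerivAt)
  refine ⟨key.1, key.2.trans ?_⟩
  rw [_root_.sum_apply]
  exact Finset.sum_congr rfl fun k hk => (h k hk).2

lemma congr (hθ : θ ∈ chamber n) (hfg : ∀ x ∈ chamber n, f x = g x) (hg : HasPD m g a θ) :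
    HasPD m f a θ := by
  have h : f =ᶠ[nhds θ] g := by
    filter_upwards [(isOpen_chamber n).mem_nhds hθ] with x hx using hfg x hx
  exact ⟨h.differentiableAt_iff.mpr hg.1, by rw [pd, h.fderiv_eq]; exact hg.2⟩

lemma congr_val (hf : HasPD m f a θ) (h : a = b) : HasPD m f b θ := h ▸ hf

end HasPD

lemma ContDiffOn.hasPD {f : (Fin n → ℝ) → ℝ} {r : WithTop ℕ∞} (hf : ContDiffOn ℝ r f (chamber n))
    (hr : r ≠ 0) (hθ : θ ∈ chamber n) (m : Fin n) : HasPD m f (pd n m f θ) θ :=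
  ⟨(hf.differentiableOn hr).differentiableAt ((isOpen_chamber n).mem_nhds hθ), rfl⟩

lemma ContDiffOn.partialDeriv {f : (Fin n → ℝ) → ℝ} {r s : WithTop ℕ∞} (hf : ContDiffOn ℝ r f (chamber n))
    (hrs : s + 1 ≤ r) (m : Fin n) : ContDiffOn ℝ s (pd n m f) (chamber n) :=
  (hf.fderiv_of_isOpen (isOpen_chamber n) hrs).clm_apply contDiffOn_const

lemma pd_comm {f : (Fin n → ℝ) → ℝ} {r : WithTop ℕ∞} (hf : ContDiffOn ℝ r f (chamber n))
    (hr : 2 ≤ r) (hθ : θ ∈ chamber n) (k m : Fin n) :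
    pd n k (pd n m f) θ = pd n m (pd n k f) θ := by
  have hU := (isOpen_chamber n).mem_nhds hθ
  have hd : DifferentiableAt ℝ (fderiv ℝ f) θ :=
    ((hf.fderiv_of_isOpen (m := 1) (isOpen_chamber n)
      (by rw [one_add_one_eq_two]; exact hr)).differentiableOn one_ne_zero).differentiableAt hU
  have hpd : ∀ a b : Fin n, pd n a (pd n b f) θ
      = fderiv ℝ (fderiv ℝ f) θ (Pi.single a 1) (Pi.single b 1) := fun a b =>
    (HasPD.of_hasFDerivAt (m := a)
      (hd.hasFDerivAt.clm_apply (hasFDerivAt_const (Pi.single b 1) θ))).2.trans (by simp)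
  have hs : IsSymmSndFDerivAt ℝ f θ := (hf.contDiffAt hU).isSymmSndFDerivAt (by simpa using hr)
  rw [hpd, hpd, hs.eq]

/-- The interaction coefficient `cot ((θ_k - θ_j) / 2)`. -/
noncomputable def cotHalf (k j : Fin n) (θ : Fin n → ℝ) : ℝ :=
  Real.cos ((θ k - θ j) / 2) / Real.sin ((θ k - θ j) / 2)

/-- `1 / (2 sin² ((θ_k - θ_j) / 2))`, written through the cotangent. -/
noncomputable def cscSqHalf (k j : Fin n) (θ : Fin n → ℝ) : ℝ :=
  (1 + cotHalf k j θ * cotHalf k j θ) / 2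

lemma one_div_sin_sq_eq (hθ : θ ∈ chamber n) {k j : Fin n} (hkj : k ≠ j) :
    1 / Real.sin ((θ k - θ j) / 2) ^ 2 = 2 * cscSqHalf k j θ := by
  have h := sin_half_sub_ne_zero hθ hkj
  have h2 := Real.sin_sq_add_cos_sq ((θ k - θ j) / 2)
  simp only [cscSqHalf, cotHalf]
  field_simp
  linarith

lemma cotHalf_swap (k j : Fin n) (θ : Fin n → ℝ) : cotHalf j k θ = -cotHalf k j θ := by
  have h : (θ j - θ k) / 2 = -((θ k - θ j) / 2) := by ring
  simp only [cotHalf, h, Real.cos_neg, Real.sin_neg, div_neg]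

lemma cscSqHalf_swap (k j : Fin n) (θ : Fin n → ℝ) : cscSqHalf j k θ = cscSqHalf k j θ := by
  simp only [cscSqHalf, cotHalf_swap k j, neg_mul_neg]

lemma cotHalf_relation (hθ : θ ∈ chamber n) {i j k : Fin n} (hij : i ≠ j) (hki : k ≠ i)
    (hkj : k ≠ j) :
    cotHalf k j θ * (cotHalf k i θ + cotHalf i j θ)
      - (cotHalf k i θ * cotHalf i j θ - 1) = 0 := by
  have h1 := sin_half_sub_ne_zero hθ hij
  have h2 := sin_half_sub_ne_zero hθ hki
  have h3 := sin_half_sub_ne_zero hθ hkj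
  have e : (θ k - θ j) / 2 = (θ k - θ i) / 2 + (θ i - θ j) / 2 := by ring
  simp only [cotHalf]
  rw [e] at h3 ⊢
  generalize (θ k - θ i) / 2 = x at *
  generalize (θ i - θ j) / 2 = y at *
  field_simp
  rw [Real.sin_add, Real.cos_add]
  ring

lemma hasPD_cotHalf (hθ : θ ∈ chamber n) {k j : Fin n} (hkj : k ≠ j) (m : Fin n) :
    HasPD m (cotHalf k j)
      (-cscSqHalf k j θ * ((if k = m then 1 else 0) - (if j = m then 1 else 0))) θ := by
  have h := sin_half_sub_ne_zero hθ hkj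
  have h1 : HasFDerivAt (fun x : Fin n → ℝ => (x k - x j) * (2 : ℝ)⁻¹) _ θ :=
    ((hasFDerivAt_apply (𝕜 := ℝ) k θ).sub (hasFDerivAt_apply (𝕜 := ℝ) j θ)).mul_const (2 : ℝ)⁻¹
  have h2 : HasDerivAt (fun x => Real.cos x / Real.sin x) _ ((θ k - θ j) * (2 : ℝ)⁻¹) :=
    (Real.hasDerivAt_cos _).div (Real.hasDerivAt_sin _) (by rwa [← div_eq_mul_inv])
  have key := HasPD.of_hasFDerivAt (m := m) (h2.comp_hasFDerivAt θ h1)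
  refine (HasPD.congr hθ (fun x _ => ?_) key).congr_val ?_
  · simp only [cotHalf, Function.comp_apply, div_eq_mul_inv]
  · have e : (θ k - θ j) * (2 : ℝ)⁻¹ = (θ k - θ j) / 2 := (div_eq_mul_inv _ _).symm
    simp only [e, cscSqHalf, cotHalf, smul_apply, sub_apply, ContinuousLinearMap.proj_apply,
      Pi.single_apply, smul_eq_mul]
    field_simp
    ring

lemma hasPD_cscSqHalf (hθ : θ ∈ chamber n) {k j : Fin n} (hkj : k ≠ j) (m : Fin n) :
    HasPD m (cscSqHalf k j) (-(cotHalf k j θ * cscSqHalf k j θ)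
      * ((if k = m then 1 else 0) - (if j = m then 1 else 0))) θ := by
  have hc := hasPD_cotHalf hθ hkj m
  have key := ((HasPD.of_hasFDerivAt (m := m) (hasFDerivAt_const (1 : ℝ) θ)).add
    (hc.mul hc)).const_mul 2⁻¹
  refine (HasPD.congr hθ (fun x _ => ?_) key).congr_val ?_
  · simp only [cscSqHalf]; ring
  · simp only [zero_apply]; ring

lemma Lop_eq (κ : ℝ) (hθ : θ ∈ chamber n) {i j : Fin n} (hij : i ≠ j) {S : Finset (Fin n)}
    (hS : ∀ k, k ∈ S ↔ k ≠ i ∧ k ≠ j) (ψ : (Fin n → ℝ) → ℝ) :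
    Lop n κ j ψ θ = κ / 2 * pd n j (pd n j ψ) θ
      + (cotHalf i j θ * pd n i ψ θ - (6 - κ) / (2 * κ) * (ψ θ * cscSqHalf i j θ))
      + ∑ k ∈ S, (cotHalf k j θ * pd n k ψ θ
          - (6 - κ) / (2 * κ) * (ψ θ * cscSqHalf k j θ)) := by
  have hi : i ∉ S := by simp [hS]
  have hT : univ.filter (fun k => k ≠ j) = insert i S := by
    ext k
    by_cases hk : k = i
    · simp [hk, hij]
    · simp [hS, hk]
  have hterm : ∀ k, k ≠ j →
      Real.cos ((θ k - θ j) / 2) / Real.sin ((θ k - θ j) / 2) * pd n k ψ θ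
          - (6 - κ) / (2 * κ) * ψ θ / (2 * Real.sin ((θ k - θ j) / 2) ^ 2)
        = cotHalf k j θ * pd n k ψ θ - (6 - κ) / (2 * κ) * (ψ θ * cscSqHalf k j θ) := by
    intro k hk
    have h := one_div_sin_sq_eq hθ hk
    have e : cscSqHalf k j θ = 1 / (2 * Real.sin ((θ k - θ j) / 2) ^ 2) := by
      rw [one_div, mul_inv, ← one_div (_ ^ 2), h]; ring
    rw [e, cotHalf]
    ring
  rw [Lop, hT, Finset.sum_insert hi, hterm i hij,
    Finset.sum_congr rfl fun k hk => hterm k ((hS k).1 hk).2]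
  ring

/-- First partial derivatives of `𝓛_j ψ`, as produced by the Leibniz rule. -/
lemma hasPD_Lop (κ : ℝ) (hθ : θ ∈ chamber n) {i j : Fin n} (hij : i ≠ j) {S : Finset (Fin n)}
    (hS : ∀ k, k ∈ S ↔ k ≠ i ∧ k ≠ j) {ψ : (Fin n → ℝ) → ℝ}
    (hψ : ContDiffOn ℝ 4 ψ (chamber n)) (m : Fin n) (δ : Fin n → ℝ)
    (hδ : ∀ k, δ k = (if k = m then 1 else 0) - (if j = m then 1 else 0)) :
    HasPD m (Lop n κ j ψ) (κ / 2 * pd n m (pd n j (pd n j ψ)) θ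
      + (cotHalf i j θ * pd n m (pd n i ψ) θ + pd n i ψ θ * (-cscSqHalf i j θ * δ i)
        - (6 - κ) / (2 * κ) * (ψ θ * (-(cotHalf i j θ * cscSqHalf i j θ) * δ i)
          + cscSqHalf i j θ * pd n m ψ θ))
      + ∑ k ∈ S, (cotHalf k j θ * pd n m (pd n k ψ) θ + pd n k ψ θ * (-cscSqHalf k j θ * δ k)
        - (6 - κ) / (2 * κ) * (ψ θ * (-(cotHalf k j θ * cscSqHalf k j θ) * δ k)
          + cscSqHalf k j θ * pd n m ψ θ))) θ := by
  have h3 : ∀ k, ContDiffOn ℝ 3 (pd n k ψ) (chamber n) := fun k => hψ.partialDeriv (by norm_num) k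
  have h2 : ∀ k l, ContDiffOn ℝ 2 (pd n k (pd n l ψ)) (chamber n) :=
    fun k l => (h3 l).partialDeriv (by norm_num) k
  have hterm : ∀ k, k ≠ j → HasPD m (fun x => cotHalf k j x * pd n k ψ x
      - (6 - κ) / (2 * κ) * (ψ x * cscSqHalf k j x))
      (cotHalf k j θ * pd n m (pd n k ψ) θ + pd n k ψ θ * (-cscSqHalf k j θ * δ k)
        - (6 - κ) / (2 * κ) * (ψ θ * (-(cotHalf k j θ * cscSqHalf k j θ) * δ k)
          + cscSqHalf k j θ * pd n m ψ θ)) θ := by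
    intro k hk
    rw [hδ]
    exact ((hasPD_cotHalf hθ hk m).mul ((h3 k).hasPD (by norm_num) hθ m)).sub
      (((hψ.hasPD (by norm_num) hθ m).mul (hasPD_cscSqHalf hθ hk m)).const_mul _)
  exact HasPD.congr hθ (fun x hx => Lop_eq κ hx hij hS ψ)
    (((((h2 j j).hasPD (by norm_num) hθ m).const_mul _).add (hterm i hij)).add
      (HasPD.sum S fun k hk => hterm k ((hS k).1 hk).2))

lemma pd_pd_Lop (κ : ℝ) (hθ : θ ∈ chamber n) {i j : Fin n} (hij : i ≠ j) {S : Finset (Fin n)}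
    (hS : ∀ k, k ∈ S ↔ k ≠ i ∧ k ≠ j) {ψ : (Fin n → ℝ) → ℝ}
    (hψ : ContDiffOn ℝ 4 ψ (chamber n)) :
    pd n i (pd n i (Lop n κ j ψ)) θ = κ / 2 * pd n i (pd n i (pd n j (pd n j ψ))) θ
      + (cotHalf i j θ * pd n i (pd n i (pd n i ψ)) θ
        - 2 * (cscSqHalf i j θ * pd n i (pd n i ψ) θ)
        + cotHalf i j θ * cscSqHalf i j θ * pd n i ψ θ
        - (6 - κ) / (2 * κ) * (cscSqHalf i j θ * pd n i (pd n i ψ) θ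
          - 2 * (cotHalf i j θ * cscSqHalf i j θ * pd n i ψ θ)
          + ψ θ * (cscSqHalf i j θ * cscSqHalf i j θ
            + cotHalf i j θ * cotHalf i j θ * cscSqHalf i j θ)))
      + ∑ k ∈ S, (cotHalf k j θ * pd n i (pd n i (pd n k ψ)) θ
        - (6 - κ) / (2 * κ) * (cscSqHalf k j θ * pd n i (pd n i ψ) θ)) := by
  have h3 : ∀ k, ContDiffOn ℝ 3 (pd n k ψ) (chamber n) := fun k => hψ.partialDeriv (by norm_num) k
  have h2 : ∀ k l, ContDiffOn ℝ 2 (pd n k (pd n l ψ)) (chamber n) :=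
    fun k l => (h3 l).partialDeriv (by norm_num) k
  have h1 : ∀ k l m, ContDiffOn ℝ 1 (pd n k (pd n l (pd n m ψ))) (chamber n) :=
    fun k l m => (h2 l m).partialDeriv (by norm_num) k
  have hfirst : ∀ x ∈ chamber n, pd n i (Lop n κ j ψ) x
      = κ / 2 * pd n i (pd n j (pd n j ψ)) x
      + (cotHalf i j x * pd n i (pd n i ψ) x - cscSqHalf i j x * pd n i ψ x
        - (6 - κ) / (2 * κ) * (cscSqHalf i j x * pd n i ψ x
          - ψ x * (cotHalf i j x * cscSqHalf i j x)))
      + ∑ k ∈ S, (cotHalf k j x * pd n i (pd n k ψ) x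
        - (6 - κ) / (2 * κ) * (cscSqHalf k j x * pd n i ψ x)) := by
    intro x hx
    rw [(hasPD_Lop κ hx hij hS hψ i _ fun k => rfl).2]
    congr 1
    · simp only [if_true, if_neg hij.symm]
      ring
    · refine Finset.sum_congr rfl fun k hk => ?_
      simp only [if_neg ((hS k).1 hk).1, if_neg hij.symm]
      ring
  have hψi := hψ.hasPD (by norm_num) hθ i
  have hψii := (h3 i).hasPD (by norm_num) hθ i
  have hψiii := (h2 i i).hasPD (by norm_num) hθ i
  have hc := (hasPD_cotHalf hθ hij i).congr_val (b := -cscSqHalf i j θ)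
    (by simp [hij.symm])
  have hb := (hasPD_cscSqHalf hθ hij i).congr_val (b := -(cotHalf i j θ * cscSqHalf i j θ))
    (by simp [hij.symm])
  have hterm : ∀ k ∈ S, HasPD i (fun x => cotHalf k j x * pd n i (pd n k ψ) x
        - (6 - κ) / (2 * κ) * (cscSqHalf k j x * pd n i ψ x))
      (cotHalf k j θ * pd n i (pd n i (pd n k ψ)) θ
        - (6 - κ) / (2 * κ) * (cscSqHalf k j θ * pd n i (pd n i ψ) θ)) θ := by
    intro k hk
    have hkj := ((hS k).1 hk).2
    refine (((hasPD_cotHalf hθ hkj i).mul ((h2 i k).hasPD (by norm_num) hθ i)).sub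
      (((hasPD_cscSqHalf hθ hkj i).mul hψii).const_mul _)).congr_val ?_
    simp only [if_neg ((hS k).1 hk).1, if_neg hij.symm]
    ring
  have key := (((((h1 i j j).hasPD (by norm_num) hθ i).const_mul (κ / 2)).add
    (((hc.mul hψiii).sub (hb.mul hψii)).sub
      (((hb.mul hψii).sub (hψi.mul (hc.mul hb))).const_mul ((6 - κ) / (2 * κ))))).add
    (HasPD.sum S hterm))
  rw [(HasPD.congr hθ hfirst key).2]
  ring

/-- The composition `𝓛_i 𝓛_j ψ`, with the sums over the indices other than `i`, `j` collected. -/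
lemma Lop_Lop (κ : ℝ) (hθ : θ ∈ chamber n) {i j : Fin n} (hij : i ≠ j) {S : Finset (Fin n)}
    (hS : ∀ k, k ∈ S ↔ k ≠ i ∧ k ≠ j) {ψ : (Fin n → ℝ) → ℝ}
    (hψ : ContDiffOn ℝ 4 ψ (chamber n)) :
    Lop n κ i (Lop n κ j ψ) θ =
      κ / 2 * (κ / 2 * pd n i (pd n i (pd n j (pd n j ψ))) θ
        + (cotHalf i j θ * pd n i (pd n i (pd n i ψ)) θ
          - 2 * (cscSqHalf i j θ * pd n i (pd n i ψ) θ)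
          + cotHalf i j θ * cscSqHalf i j θ * pd n i ψ θ
          - (6 - κ) / (2 * κ) * (cscSqHalf i j θ * pd n i (pd n i ψ) θ
            - 2 * (cotHalf i j θ * cscSqHalf i j θ * pd n i ψ θ)
            + ψ θ * (cscSqHalf i j θ * cscSqHalf i j θ
              + cotHalf i j θ * cotHalf i j θ * cscSqHalf i j θ)))
        + (∑ k ∈ S, cotHalf k j θ * pd n i (pd n i (pd n k ψ)) θ
          - (6 - κ) / (2 * κ) * ((∑ k ∈ S, cscSqHalf k j θ) * pd n i (pd n i ψ) θ)))
      - cotHalf i j θ * (κ / 2 * pd n j (pd n j (pd n j ψ)) θ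
        + (cotHalf i j θ * pd n j (pd n i ψ) θ + cscSqHalf i j θ * pd n i ψ θ
          - (6 - κ) / (2 * κ) * (cscSqHalf i j θ * pd n j ψ θ
            + ψ θ * (cotHalf i j θ * cscSqHalf i j θ)))
        + (∑ k ∈ S, cotHalf k j θ * pd n j (pd n k ψ) θ + ∑ k ∈ S, cscSqHalf k j θ * pd n k ψ θ
          - (6 - κ) / (2 * κ) * ((∑ k ∈ S, cscSqHalf k j θ) * pd n j ψ θ
            + ψ θ * ∑ k ∈ S, cotHalf k j θ * cscSqHalf k j θ)))
      - (6 - κ) / (2 * κ) * (Lop n κ j ψ θ * (cscSqHalf i j θ + ∑ k ∈ S, cscSqHalf k i θ))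
      + (κ / 2 * ∑ k ∈ S, cotHalf k i θ * pd n k (pd n j (pd n j ψ)) θ
        + cotHalf i j θ * ∑ k ∈ S, cotHalf k i θ * pd n k (pd n i ψ) θ
        - (6 - κ) / (2 * κ) * ((cscSqHalf i j θ + ∑ k ∈ S, cscSqHalf k j θ)
            * ∑ k ∈ S, cotHalf k i θ * pd n k ψ θ)
        - ∑ k ∈ S, cotHalf k i θ * cscSqHalf k j θ * pd n k ψ θ
        + (6 - κ) / (2 * κ) * (ψ θ * ∑ k ∈ S, cotHalf k i θ * cotHalf k j θ * cscSqHalf k j θ)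
        + ∑ m ∈ S, ∑ k ∈ S, cotHalf m i θ * cotHalf k j θ * pd n m (pd n k ψ) θ) := by
  have hS' : ∀ k, k ∈ S ↔ k ≠ j ∧ k ≠ i := fun k => (hS k).trans and_comm
  have hj : pd n j (Lop n κ j ψ) θ = κ / 2 * pd n j (pd n j (pd n j ψ)) θ
        + (cotHalf i j θ * pd n j (pd n i ψ) θ + cscSqHalf i j θ * pd n i ψ θ
          - (6 - κ) / (2 * κ) * (cscSqHalf i j θ * pd n j ψ θ
            + ψ θ * (cotHalf i j θ * cscSqHalf i j θ)))
        + (∑ k ∈ S, cotHalf k j θ * pd n j (pd n k ψ) θ + ∑ k ∈ S, cscSqHalf k j θ * pd n k ψ θ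
          - (6 - κ) / (2 * κ) * ((∑ k ∈ S, cscSqHalf k j θ) * pd n j ψ θ
            + ψ θ * ∑ k ∈ S, cotHalf k j θ * cscSqHalf k j θ)) := by
    rw [(hasPD_Lop κ hθ hij hS hψ j _ fun k => rfl).2]
    congr 1
    · simp only [if_true, if_neg hij]
      ring
    · rw [Finset.sum_mul, Finset.mul_sum, ← Finset.sum_add_distrib, ← Finset.sum_add_distrib,
        Finset.mul_sum, ← Finset.sum_sub_distrib]
      refine Finset.sum_congr rfl fun k hk => ?_
      simp only [if_true, if_neg ((hS k).1 hk).2]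
      ring
  have hm : ∀ m ∈ S, pd n m (Lop n κ j ψ) θ = κ / 2 * pd n m (pd n j (pd n j ψ)) θ
        + cotHalf i j θ * pd n m (pd n i ψ) θ
        - (6 - κ) / (2 * κ) * ((cscSqHalf i j θ + ∑ k ∈ S, cscSqHalf k j θ) * pd n m ψ θ)
        - cscSqHalf m j θ * pd n m ψ θ
        + (6 - κ) / (2 * κ) * (ψ θ * (cotHalf m j θ * cscSqHalf m j θ))
        + ∑ k ∈ S, cotHalf k j θ * pd n m (pd n k ψ) θ := by
    intro m hm
    obtain ⟨hmi, hmj⟩ := (hS m).1 hm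
    have hsum : ∑ k ∈ S, (if k = m then - cscSqHalf k j θ * pd n k ψ θ
        + (6 - κ) / (2 * κ) * (ψ θ * (cotHalf k j θ * cscSqHalf k j θ)) else 0)
        = - cscSqHalf m j θ * pd n m ψ θ
        + (6 - κ) / (2 * κ) * (ψ θ * (cotHalf m j θ * cscSqHalf m j θ)) := by
      rw [Finset.sum_ite_eq', if_pos hm]
    have hrest : ∑ k ∈ S, (cotHalf k j θ * pd n m (pd n k ψ) θ + pd n k ψ θ
          * (-cscSqHalf k j θ * ((if k = m then 1 else 0) - (if j = m then 1 else 0)))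
        - (6 - κ) / (2 * κ) * (ψ θ * (-(cotHalf k j θ * cscSqHalf k j θ)
          * ((if k = m then 1 else 0) - (if j = m then 1 else 0)))
          + cscSqHalf k j θ * pd n m ψ θ))
        = ∑ k ∈ S, cotHalf k j θ * pd n m (pd n k ψ) θ
          + ∑ k ∈ S, (if k = m then - cscSqHalf k j θ * pd n k ψ θ
            + (6 - κ) / (2 * κ) * (ψ θ * (cotHalf k j θ * cscSqHalf k j θ)) else 0)
          - (6 - κ) / (2 * κ) * ((∑ k ∈ S, cscSqHalf k j θ) * pd n m ψ θ) := by
      rw [Finset.sum_mul, Finset.mul_sum, ← Finset.sum_add_distrib, ← Finset.sum_sub_distrib]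
      refine Finset.sum_congr rfl fun k _ => ?_
      rw [if_neg hmj.symm]
      split_ifs <;> ring
    rw [(hasPD_Lop κ hθ hij hS hψ m _ fun k => rfl).2, hrest, hsum]
    simp only [if_neg hmi.symm, if_neg hmj.symm]
    ring
  have hlast : ∑ k ∈ S, (cotHalf k i θ * pd n k (Lop n κ j ψ) θ
        - (6 - κ) / (2 * κ) * (Lop n κ j ψ θ * cscSqHalf k i θ))
      = (κ / 2 * ∑ k ∈ S, cotHalf k i θ * pd n k (pd n j (pd n j ψ)) θ
        + cotHalf i j θ * ∑ k ∈ S, cotHalf k i θ * pd n k (pd n i ψ) θ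
        - (6 - κ) / (2 * κ) * ((cscSqHalf i j θ + ∑ k ∈ S, cscSqHalf k j θ)
            * ∑ k ∈ S, cotHalf k i θ * pd n k ψ θ)
        - ∑ k ∈ S, cotHalf k i θ * cscSqHalf k j θ * pd n k ψ θ
        + (6 - κ) / (2 * κ) * (ψ θ * ∑ k ∈ S, cotHalf k i θ * cotHalf k j θ * cscSqHalf k j θ)
        + ∑ m ∈ S, ∑ k ∈ S, cotHalf m i θ * cotHalf k j θ * pd n m (pd n k ψ) θ)
        - (6 - κ) / (2 * κ) * (Lop n κ j ψ θ * ∑ k ∈ S, cscSqHalf k i θ) := by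
    generalize hB : cscSqHalf i j θ + ∑ k ∈ S, cscSqHalf k j θ = B at hm ⊢
    simp only [Finset.mul_sum]
    simp only [← Finset.sum_add_distrib, ← Finset.sum_sub_distrib]
    refine Finset.sum_congr rfl fun m hmS => ?_
    rw [hm m hmS]
    simp only [mul_assoc, ← Finset.mul_sum]
    ring
  have hdiag : ∑ k ∈ S, (cotHalf k j θ * pd n i (pd n i (pd n k ψ)) θ
        - (6 - κ) / (2 * κ) * (cscSqHalf k j θ * pd n i (pd n i ψ) θ))
      = ∑ k ∈ S, cotHalf k j θ * pd n i (pd n i (pd n k ψ)) θ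
        - (6 - κ) / (2 * κ) * ((∑ k ∈ S, cscSqHalf k j θ) * pd n i (pd n i ψ) θ) := by
    rw [Finset.sum_mul, Finset.mul_sum, ← Finset.sum_sub_distrib]
  rw [Lop_eq κ hθ hij.symm hS' (Lop n κ j ψ), hlast, pd_pd_Lop κ hθ hij hS hψ, hdiag, hj,
    cotHalf_swap i j, cscSqHalf_swap i j]
  ring

end NullVectorCommutation

theorem stmt9 (κ : ℝ) (hκ : κ ≠ 0) (n : ℕ) (hn : 2 ≤ n)
    (i j : Fin n) (hij : i ≠ j)
    (ψ : (Fin n → ℝ) → ℝ) (hψ : ContDiffOn ℝ 4 ψ (chamber n))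
    (θ : Fin n → ℝ) (hθ : θ ∈ chamber n) :
    Lop n κ i (Lop n κ j ψ) θ - Lop n κ j (Lop n κ i ψ) θ
      = (1 / Real.sin ((θ i - θ j) / 2) ^ 2) * (Lop n κ j ψ θ - Lop n κ i ψ θ) := by
  obtain ⟨S, hS⟩ : ∃ S : Finset (Fin n), ∀ k, k ∈ S ↔ k ≠ i ∧ k ≠ j :=
    ⟨univ.filter fun k => k ≠ i ∧ k ≠ j, by simp⟩
  have hS' : ∀ k, k ∈ S ↔ k ≠ j ∧ k ≠ i := fun k => (hS k).trans and_comm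
  have h3 : ∀ k, ContDiffOn ℝ 3 (pd n k ψ) (chamber n) := fun k => hψ.partialDeriv (by norm_num) k
  have h2 : ∀ k l, ContDiffOn ℝ 2 (pd n k (pd n l ψ)) (chamber n) :=
    fun k l => (h3 l).partialDeriv (by norm_num) k
  have hsymm : ∀ x ∈ chamber n, ∀ k m, pd n k (pd n m ψ) x = pd n m (pd n k ψ) x :=
    fun x hx => pd_comm hψ (by norm_num) hx
  have hcongr : ∀ (f g : (Fin n → ℝ) → ℝ), (∀ x ∈ chamber n, f x = g x) →
      ∀ x ∈ chamber n, ∀ m, pd n m f x = pd n m g x := by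
    intro f g hfg x hx m
    have h : f =ᶠ[nhds x] g := by
      filter_upwards [(isOpen_chamber n).mem_nhds hx] with y hy using hfg y hy
    rw [pd, h.fderiv_eq, pd]
  have hthird : ∀ x ∈ chamber n, ∀ k m, pd n k (pd n m (pd n m ψ)) x
      = pd n m (pd n m (pd n k ψ)) x := by
    intro x hx k m
    rw [pd_comm (h3 m) (by norm_num) hx]
    exact hcongr _ _ (fun y hy => hsymm y hy k m) x hx m
  have hfourth : pd n j (pd n j (pd n i (pd n i ψ))) θ
      = pd n i (pd n i (pd n j (pd n j ψ))) θ := by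
    rw [hcongr _ _ (fun y hy => hthird y hy j i) θ hθ j, pd_comm (h2 i j) le_rfl hθ]
    refine hcongr _ _ (fun y hy => ?_) θ hθ i
    exact pd_comm (h3 j) (by norm_num) hy j i
  have hdouble : ∑ m ∈ S, ∑ k ∈ S, cotHalf m j θ * cotHalf k i θ * pd n m (pd n k ψ) θ
      = ∑ m ∈ S, ∑ k ∈ S, cotHalf m i θ * cotHalf k j θ * pd n m (pd n k ψ) θ := by
    rw [Finset.sum_comm]
    refine Finset.sum_congr rfl fun m _ => Finset.sum_congr rfl fun k _ => ?_
    rw [hsymm θ hθ]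
    ring
  have hgrad : - cotHalf i j θ * ∑ k ∈ S, cscSqHalf k j θ * pd n k ψ θ
      - ∑ k ∈ S, cotHalf k i θ * cscSqHalf k j θ * pd n k ψ θ
      - cotHalf i j θ * ∑ k ∈ S, cscSqHalf k i θ * pd n k ψ θ
      + ∑ k ∈ S, cotHalf k j θ * cscSqHalf k i θ * pd n k ψ θ
      = 2 * cscSqHalf i j θ * (∑ k ∈ S, cotHalf k j θ * pd n k ψ θ
        - ∑ k ∈ S, cotHalf k i θ * pd n k ψ θ) := by
    simp only [mul_sub, Finset.mul_sum, ← Finset.sum_add_distrib, ← Finset.sum_sub_distrib]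
    refine Finset.sum_congr rfl fun k hk => ?_
    have h := cotHalf_relation hθ hij ((hS k).1 hk).1 ((hS k).1 hk).2
    simp only [cscSqHalf]
    linear_combination pd n k ψ θ * ((cotHalf k i θ - cotHalf k j θ) / 2 - cotHalf i j θ) * h
  have hpot : cotHalf i j θ * ∑ k ∈ S, cotHalf k j θ * cscSqHalf k j θ
      + ∑ k ∈ S, cotHalf k i θ * cotHalf k j θ * cscSqHalf k j θ
      + cotHalf i j θ * ∑ k ∈ S, cotHalf k i θ * cscSqHalf k i θ
      - ∑ k ∈ S, cotHalf k j θ * cotHalf k i θ * cscSqHalf k i θ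
      = 2 * cscSqHalf i j θ * (∑ k ∈ S, cscSqHalf k i θ - ∑ k ∈ S, cscSqHalf k j θ) := by
    simp only [mul_sub, Finset.mul_sum, ← Finset.sum_add_distrib, ← Finset.sum_sub_distrib]
    refine Finset.sum_congr rfl fun k hk => ?_
    have h := cotHalf_relation hθ hij ((hS k).1 hk).1 ((hS k).1 hk).2
    simp only [cscSqHalf]
    linear_combination ((1 + cotHalf k j θ ^ 2) / 2 - (1 + cotHalf k i θ ^ 2) / 2
      + (cotHalf k i θ + cotHalf k j θ) * cotHalf i j θ / 2) * h
  have hLop : ∀ a b : Fin n, a ≠ b → (∀ k, k ∈ S ↔ k ≠ a ∧ k ≠ b) →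
      Lop n κ b ψ θ = κ / 2 * pd n b (pd n b ψ) θ
        + (cotHalf a b θ * pd n a ψ θ - (6 - κ) / (2 * κ) * (ψ θ * cscSqHalf a b θ))
        + (∑ k ∈ S, cotHalf k b θ * pd n k ψ θ
          - (6 - κ) / (2 * κ) * (ψ θ * ∑ k ∈ S, cscSqHalf k b θ)) := by
    intro a b hab hSab
    rw [Lop_eq κ hθ hab hSab ψ, Finset.sum_sub_distrib, ← Finset.mul_sum, ← Finset.mul_sum]
  rw [Lop_Lop κ hθ hij hS hψ, Lop_Lop κ hθ hij.symm hS' hψ, one_div_sin_sq_eq hθ hij,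
    hLop i j hij hS, hLop j i hij.symm hS', hdouble, hfourth, cotHalf_swap i j, cscSqHalf_swap i j]
  have hsum3 : ∀ a b, ∑ k ∈ S, cotHalf k a θ * pd n k (pd n b (pd n b ψ)) θ
      = ∑ k ∈ S, cotHalf k a θ * pd n b (pd n b (pd n k ψ)) θ := fun a b =>
    Finset.sum_congr rfl fun k _ => by rw [hthird θ hθ]
  have hsum2 : ∀ a b, ∑ k ∈ S, cotHalf k a θ * pd n k (pd n b ψ) θ
      = ∑ k ∈ S, cotHalf k a θ * pd n b (pd n k ψ) θ := fun a b =>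
    Finset.sum_congr rfl fun k _ => by rw [hsymm θ hθ]
  simp only [hsum3, hsum2, hsymm θ hθ j i]
  have hw : κ * ((6 - κ) / (2 * κ)) = (6 - κ) / 2 := by field_simp
  generalize (6 - κ) / (2 * κ) = w at hw ⊢
  linear_combination hgrad + w * ψ θ * hpot
    + cotHalf i j θ * cscSqHalf i j θ * (pd n i ψ θ + pd n j ψ θ) * hw
end

section
/- Let n ≥ 1, m ≥ 0, let θ_1,…,θ_n be real numbers and ζ_1,…,ζ_m complex numbers, closed under complex conjugation as a list, such that sin((θ_j−θ_k)/2) ≠ 0 for all j ≠ k, sin((ζ_k−ζ_l)/2) ≠ 0 for all k ≠ l, and sin((θ_j−ζ_l)/2) ≠ 0 for all j,l, and assume the angular stationary relations hold: Σ_{j=1}^n cot((ζ_k−θ_j)/2) = 2 Σ_{l≠k} cot((ζ_k−ζ_l)/2) for every k. With U_j = Σ_{k≠j} cot((θ_j−θ_k)/2) − 2 Σ_{l=1}^m cot((θ_j−ζ_l)/2) and p_j = U_j + Σ_{k≠j} cot((θ_j−θ_k)/2), the energy of the system is Σ_{j=1}^n p_j^2/2 − 4·Σ_{1≤j<k≤n}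 1/sin^2((θ_j−θ_k)/2) = −n(2m−n)^2/2 + n/2 − n(n^2−1)/6. -/
open Finset

/-- The complex cotangent. -/
noncomputable def ccot (w : ℂ) : ℂ := Complex.cos w / Complex.sin w

/-- The drift functions `U_j` of the multiple radial SLE(0) system in angular coordinates. -/
noncomputable def Ufn (n m : ℕ) (θ : Fin n → ℝ) (ζ : Fin m → ℂ) (j : Fin n) : ℂ :=
  (∑ k ∈ univ.filter (fun k => k ≠ j), ccot (((θ j : ℂ) - (θ k : ℂ)) / 2))
    - 2 * ∑ l, ccot (((θ j : ℂ) - ζ l) / 2)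

/-- The momentum `p_j = U_j + Σ_{k≠j} cot((θ_j − θ_k)/2)`. -/
noncomputable def pfn (n m : ℕ) (θ : Fin n → ℝ) (ζ : Fin m → ℂ) (j : Fin n) : ℂ :=
  Ufn n m θ ζ j
    + ∑ k ∈ univ.filter (fun k => k ≠ j), ccot (((θ j : ℂ) - (θ k : ℂ)) / 2)

theorem ccot_zero : ccot 0 = 0 := by simp [ccot]

theorem ccot_neg (w : ℂ) : ccot (-w) = -ccot w := by
  simp [ccot, div_neg]

theorem one_div_sin_sq {w : ℂ} (hw : Complex.sin w ≠ 0) :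
    1 / Complex.sin w ^ 2 = 1 + ccot w ^ 2 := by
  unfold ccot
  field_simp
  linear_combination -Complex.sin_sq_add_cos_sq w

/-- The cotangent addition formula, cleared of denominators. -/
theorem ccot_sub_mul {u v : ℂ} (hu : Complex.sin u ≠ 0) (hv : Complex.sin v ≠ 0)
    (huv : Complex.sin (u - v) ≠ 0) :
    ccot (u - v) * (ccot u - ccot v) = -1 - ccot u * ccot v := by
  have h1 : ccot u - ccot v = -Complex.sin (u - v) / (Complex.sin u * Complex.sin v) := by
    unfold ccot
    rw [Complex.sin_sub]
    field_simp
    ring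
  have h2 : -1 - ccot u * ccot v
      = -Complex.cos (u - v) / (Complex.sin u * Complex.sin v) := by
    unfold ccot
    rw [Complex.cos_sub]
    field_simp
    ring
  rw [h1, h2]
  unfold ccot
  field_simp

theorem ccot_half_sub_comm (u v : ℂ) : ccot ((u - v) / 2) = -ccot ((v - u) / 2) := by
  rw [← ccot_neg]
  congr 1
  ring

/-- The diagonal term vanishes because of the convention `ccot 0 = 0`. -/
theorem sum_filter_ne_ccot {ι : Type*} [Fintype ι] [DecidableEq ι] (x : ι → ℂ) (j : ι) :
    ∑ k ∈ univ.filter (fun k => k ≠ j), ccot ((x j - x k) / 2)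
      = ∑ k, ccot ((x j - x k) / 2) := by
  rw [sum_filter]
  refine sum_congr rfl fun k _ => ?_
  split_ifs with h
  · rfl
  · rw [not_not] at h
    simp [h, ccot_zero]

theorem two_mul_sum_ccot_mul_ccot {ι : Type*} [Fintype ι] [DecidableEq ι] (x : ι → ℂ) (y : ℂ)
    (hx : ∀ j k, j ≠ k → Complex.sin ((x j - x k) / 2) ≠ 0)
    (hy : ∀ j, Complex.sin ((x j - y) / 2) ≠ 0) :
    2 * ∑ j, (∑ k, ccot ((x j - x k) / 2)) * ccot ((x j - y) / 2)
      = (Fintype.card ι : ℂ) - (Fintype.card ι : ℂ) ^ 2 - (∑ j, ccot ((x j - y) / 2)) ^ 2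
        + ∑ j, ccot ((x j - y) / 2) ^ 2 := by
  set b : ι → ℂ := fun j => ccot ((x j - y) / 2) with hb
  have key : ∀ j k, ccot ((x j - x k) / 2) * (b j - b k)
      = -1 - b j * b k + if j = k then 1 + b j ^ 2 else 0 := by
    intro j k
    split_ifs with h
    · subst h
      ring
    · have e : (x j - x k) / 2 = (x j - y) / 2 - (x k - y) / 2 := by ring
      have := ccot_sub_mul (hy j) (hy k) (e ▸ hx j k h)
      rw [e, add_zero]
      exact this
  have swap : ∑ j, ∑ k, ccot ((x j - x k) / 2) * b k
      = -∑ j, ∑ k, ccot ((x j - x k) / 2) * b j := by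
    rw [sum_comm, ← sum_neg_distrib]
    refine sum_congr rfl fun j _ => ?_
    rw [← sum_neg_distrib]
    refine sum_congr rfl fun k _ => ?_
    rw [ccot_half_sub_comm]
    ring
  have total : ∑ j, ∑ k, ccot ((x j - x k) / 2) * (b j - b k)
      = ∑ j, ∑ k, (-1 - b j * b k + if j = k then 1 + b j ^ 2 else 0) :=
    sum_congr rfl fun j _ => sum_congr rfl fun k _ => key j k
  simp only [mul_sub, sum_sub_distrib, sum_add_distrib, swap, sum_ite_eq, mem_univ, if_true,
    sum_const, card_univ, nsmul_eq_mul, ← mul_sum, ← sum_mul] at total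
  linear_combination total

theorem sum_sq_sum_ccot {ι : Type*} [Fintype ι] [DecidableEq ι] (x : ι → ℂ)
    (hx : ∀ j k, j ≠ k → Complex.sin ((x j - x k) / 2) ≠ 0) :
    3 * ∑ j, (∑ k, ccot ((x j - x k) / 2)) ^ 2
      = 3 * ∑ j, ∑ k, ccot ((x j - x k) / 2) ^ 2 - (Fintype.card ι : ℂ) ^ 3
        + 3 * (Fintype.card ι : ℂ) ^ 2 - 2 * (Fintype.card ι : ℂ) := by
  set a : ι → ι → ℂ := fun j k => ccot ((x j - x k) / 2) with ha
  have anti : ∀ j k, a j k = -a k j := fun j k => ccot_half_sub_comm _ _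
  have diag : ∀ j, a j j = 0 := fun j => by simp [ha, ccot_zero]
  have key : ∀ j k l, a j k * a j l + a k j * a k l + a l j * a l k
      = -1 + (if j = k then 1 + a j l ^ 2 else 0) + (if k = l then 1 + a j k ^ 2 else 0)
        + (if j = l then 1 + a j k ^ 2 else 0)
        - (if j = k then if k = l then 2 else 0 else 0) := by
    intro j k l
    by_cases hjk : j = k
    · subst hjk
      by_cases hjl : j = l
      · subst hjl
        simp [diag]
        norm_num
      · simp [hjl, diag, anti l j]
        ring
    · by_cases hkl : k = l
      · subst hkl
        simp [hjk, diag]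
        ring
      · by_cases hjl : j = l
        · subst hjl
          simp [hjk, hkl, diag, anti k j]
          ring
        · have e : (x j - x k) / 2 = (x j - x l) / 2 - (x k - x l) / 2 := by ring
          have h := ccot_sub_mul (hx j l hjl) (hx k l hkl) (e ▸ hx j k hjk)
          rw [← e] at h
          change a j k * (a j l - a k l) = -1 - a j l * a k l at h
          simp only [hjk, hkl, hjl, if_false]
          rw [anti k j, anti l j, anti l k]
          linear_combination h
  have total : ∑ j, ∑ k, ∑ l, (a j k * a j l + a k j * a k l + a l j * a l k)
      = ∑ j, ∑ k, ∑ l, (-1 + (if j = k then 1 + a j l ^ 2 else 0)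
        + (if k = l then 1 + a j k ^ 2 else 0) + (if j = l then 1 + a j k ^ 2 else 0)
        - (if j = k then if k = l then 2 else 0 else 0)) :=
    sum_congr rfl fun j _ => sum_congr rfl fun k _ => sum_congr rfl fun l _ => key j k l
  have t1 : ∑ j, ∑ k, ∑ l, a j k * a j l = ∑ j, (∑ k, a j k) ^ 2 := by
    simp only [sq, sum_mul_sum]
  have t2 : ∑ j, ∑ k, ∑ l, a k j * a k l = ∑ j, (∑ k, a j k) ^ 2 := by
    rw [sum_comm, t1]
  have t3 : ∑ j, ∑ k, ∑ l, a l j * a l k = ∑ j, (∑ k, a j k) ^ 2 := by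
    rw [← t2]
    exact sum_congr rfl fun j _ => sum_comm
  have s : ∑ j, ∑ k, ∑ l, (if j = k then 1 + a j l ^ 2 else 0)
      = ∑ j, ∑ l, (1 + a j l ^ 2) := by
    refine sum_congr rfl fun j _ => ?_
    rw [sum_comm]
    simp
  have s' : ∑ j : ι, ∑ k : ι, ∑ l : ι, (if j = k then if k = l then (2 : ℂ) else 0 else 0)
      = 2 * (Fintype.card ι : ℂ) := by
    have inner : ∀ j k : ι, ∑ l : ι, (if j = k then if k = l then (2 : ℂ) else 0 else 0)
        = if j = k then 2 else 0 := by
      intro j k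
      split_ifs <;> simp
    simp [inner, mul_comm]
  simp only [sum_sub_distrib, sum_add_distrib, t1, t2, t3, s, s'] at total
  simp only [sum_add_distrib, sum_ite_eq, mem_univ, if_true,
    sum_const, card_univ, nsmul_eq_mul] at total
  linear_combination total

theorem two_mul_sum_lt_eq {n : ℕ} (f : Fin n → Fin n → ℂ) (hf : ∀ j k, f j k = f k j) :
    2 * ∑ j, ∑ k ∈ univ.filter (fun k => j < k), f j k = ∑ j, ∑ k, f j k - ∑ j, f j j := by
  have swap : ∑ j, ∑ k, (if j < k then f j k else 0)
      = ∑ j, ∑ k, (if k < j then f j k else 0) := by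
    rw [sum_comm]
    exact sum_congr rfl fun j _ => sum_congr rfl fun k _ => by rw [hf]
  have key : ∀ j k, f j k = (if j < k then f j k else 0) + (if k < j then f j k else 0)
      + if j = k then f j k else 0 := by
    intro j k
    rcases lt_trichotomy j k with h | h | h
    · simp [h, h.not_gt, h.ne]
    · simp [h]
    · simp [h, h.not_gt, h.ne']
  have total : ∑ j, ∑ k, f j k = ∑ j, ∑ k, ((if j < k then f j k else 0)
      + (if k < j then f j k else 0) + if j = k then f j k else 0) :=
    sum_congr rfl fun j _ => sum_congr rfl fun k _ => key j k
  simp only [sum_add_distrib, ← swap, sum_ite_eq, mem_univ, if_true] at total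
  simp only [sum_filter]
  linear_combination -total

theorem stmt13 (n m : ℕ) (hn : 1 ≤ n)
    (θ : Fin n → ℝ) (ζ : Fin m → ℂ)
    (σ : Fin m → Fin m) (hσ : Function.Involutive σ)
    (hconj : ∀ l, ζ (σ l) = (starRingEnd ℂ) (ζ l))
    (hθ : ∀ j k : Fin n, j ≠ k → Complex.sin (((θ j : ℂ) - (θ k : ℂ)) / 2) ≠ 0)
    (hζ : ∀ k l : Fin m, k ≠ l → Complex.sin ((ζ k - ζ l) / 2) ≠ 0)
    (hθζ : ∀ (j : Fin n) (l : Fin m), Complex.sin (((θ j : ℂ) - ζ l) / 2) ≠ 0)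
    (hstat : ∀ k : Fin m,
      ∑ j, ccot ((ζ k - (θ j : ℂ)) / 2)
        = 2 * ∑ l ∈ univ.filter (fun l => l ≠ k), ccot ((ζ k - ζ l) / 2)) :
    ∑ j, pfn n m θ ζ j ^ 2 / 2
      - 4 * ∑ j, ∑ k ∈ univ.filter (fun k => j < k),
          1 / Complex.sin (((θ j : ℂ) - (θ k : ℂ)) / 2) ^ 2
      = -(n : ℂ) * (2 * (m : ℂ) - (n : ℂ)) ^ 2 / 2 + (n : ℂ) / 2
        - (n : ℂ) * ((n : ℂ) ^ 2 - 1) / 6 := by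
  have hsin : ∑ j, ∑ k ∈ univ.filter (fun k => j < k),
        1 / Complex.sin (((θ j : ℂ) - (θ k : ℂ)) / 2) ^ 2
      = ∑ j, ∑ k ∈ univ.filter (fun k => j < k), (1 + ccot (((θ j : ℂ) - (θ k : ℂ)) / 2) ^ 2) :=
    sum_congr rfl fun j _ => sum_congr rfl fun k hk =>
      one_div_sin_sq (hθ j k (mem_filter.1 hk).2.ne)
  have hlt := two_mul_sum_lt_eq (fun j k => 1 + ccot (((θ j : ℂ) - (θ k : ℂ)) / 2) ^ 2)
    fun j k => by rw [ccot_half_sub_comm]; ring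
  rw [← hsin] at hlt
  simp only [sub_self, zero_div, ccot_zero, sum_add_distrib, sum_const, card_univ,
    Fintype.card_fin, nsmul_eq_mul] at hlt
  have hA := sum_sq_sum_ccot (fun j => (θ j : ℂ)) hθ
  have hAB : ∀ l, _ := fun l => two_mul_sum_ccot_mul_ccot (fun j => (θ j : ℂ)) (ζ l) hθ
    fun j => hθζ j l
  have hBB : ∀ j, _ := fun j => two_mul_sum_ccot_mul_ccot ζ (θ j : ℂ) hζ fun l => by
    rw [show (ζ l - (θ j : ℂ)) / 2 = -(((θ j : ℂ) - ζ l) / 2) by ring, Complex.sin_neg]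
    exact neg_ne_zero.2 (hθζ j l)
  simp only [sum_filter_ne_ccot ζ, ccot_half_sub_comm (ζ _) (θ _ : ℂ), sum_neg_distrib,
    mul_neg, neg_sq, Fintype.card_fin] at hstat hA hAB hBB
  have hp : ∀ j, pfn n m θ ζ j = 2 * ((∑ k, ccot (((θ j : ℂ) - (θ k : ℂ)) / 2))
      - ∑ l, ccot (((θ j : ℂ) - ζ l) / 2)) := by
    intro j
    rw [pfn, Ufn, sum_filter_ne_ccot (fun j => (θ j : ℂ))]
    ring
  simp only [hp]
  set A : Fin n → ℂ := fun j => ∑ k, ccot (((θ j : ℂ) - (θ k : ℂ)) / 2) with hAdef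
  set C : Fin m → ℂ := fun k => ∑ l, ccot ((ζ k - ζ l) / 2) with hCdef
  set b : Fin n → Fin m → ℂ := fun j l => ccot (((θ j : ℂ) - ζ l) / 2) with hbdef
  have hs : ∀ l, ∑ j, b j l = -(2 * C l) := fun l => by rw [← hstat l, neg_neg]
  have hAB' : 2 * ∑ j, A j * ∑ l, b j l
      = m * ((n : ℂ) - n ^ 2) - 4 * ∑ l, C l ^ 2 + ∑ j, ∑ l, b j l ^ 2 := by
    have h : ∑ l, 2 * ∑ j, A j * b j l
        = ∑ l, ((n : ℂ) - n ^ 2 - (∑ j, b j l) ^ 2 + ∑ j, b j l ^ 2) :=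
      sum_congr rfl fun l _ => hAB l
    simp only [hs, neg_sq, mul_pow, sum_add_distrib, sum_sub_distrib, ← mul_sum, sum_const,
      card_univ, Fintype.card_fin, nsmul_eq_mul] at h
    rw [sum_comm, sum_comm (f := fun l j => b j l ^ 2)] at h
    simp only [← mul_sum] at h
    linear_combination h
  have hBB' : 4 * ∑ l, C l ^ 2
      = n * ((m : ℂ) - m ^ 2) - ∑ j, (∑ l, b j l) ^ 2 + ∑ j, ∑ l, b j l ^ 2 := by
    have h : ∑ j, -(2 * ∑ l, C l * b j l)
        = ∑ j, ((m : ℂ) - m ^ 2 - (∑ l, b j l) ^ 2 + ∑ l, b j l ^ 2) :=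
      sum_congr rfl fun j _ => hBB j
    rw [sum_neg_distrib, ← mul_sum, sum_comm] at h
    simp only [← mul_sum, hs] at h
    have h' : ∑ l, C l * -(2 * C l) = -(2 * ∑ l, C l ^ 2) := by
      rw [mul_sum, ← sum_neg_distrib]
      exact sum_congr rfl fun l _ => by ring
    rw [h'] at h
    simp only [sum_add_distrib, sum_sub_distrib, sum_const, card_univ, Fintype.card_fin,
      nsmul_eq_mul] at h
    linear_combination h
  have hsq : ∑ j, (2 * (A j - ∑ l, b j l)) ^ 2 / 2
      = 2 * ∑ j, A j ^ 2 - 4 * ∑ j, A j * ∑ l, b j l + 2 * ∑ j, (∑ l, b j l) ^ 2 := by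
    simp only [mul_sum _ _ (2 : ℂ), mul_sum _ _ (4 : ℂ), ← sum_sub_distrib, ← sum_add_distrib]
    exact sum_congr rfl fun j _ => by ring
  rw [hsq]
  linear_combination (2 / 3) * hA - 2 * hAB' - 2 * hlt + 2 * hBB'
end
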